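/- Cumulative posterior standard deviation under a Matérn-type information-gain bound, case d > ν: assume k(x, x) ≤ 1 for all x ∈ X, that the Matérn-type information-gain hypothesis holds, and that d > ν. Then for every T ∈ ℕ₊ and every sequence x₁, …, x_T ∈ X, ∑_{t=1}^T σ(x_t; X_{t−1}) ≤ T̄_Mat + C̃_Mat^{1/2} · (d/(d−ν)) · T^{(d−ν)/d} · (ln T)^{ν/d}. -/

import Mathlib

open Matrix

noncomputable section

/-- Gram matrix `K = [k(x_i, x_j)]` of the kernel `k` on the finite family `xs`. -/
def gram {X ι : Type*} [Fintype ι] (k : X → X → ℝ) (xs : ι → X) :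
    Matrix ι ι ℝ := fun i j => k (xs i) (xs j)

/-- Kernel vector `k_t(x) = (k(x₁, x), …, k(x_t, x))`. -/
def kvec {X ι : Type*} [Fintype ι] (k : X → X → ℝ) (xs : ι → X) (x : X) :
    ι → ℝ := fun i => k (xs i) x

/-- Regularized posterior variance `σ²_{λ²}(x; xs) = k(x,x) - k_t(x)ᵀ (K + λ² I)⁻¹ k_t(x)`.
For the empty family this is `k(x,x)`. -/
def postVar {X ι : Type*} [Fintype ι] [DecidableEq ι] (k : X → X → ℝ)
    (xs : ι → X) (lam : ℝ) (x : X) : ℝ :=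
  k x x - kvec k xs x ⬝ᵥ ((gram k xs + lam ^ 2 • (1 : Matrix ι ι ℝ))⁻¹ *ᵥ kvec k xs x)

/-- Noise-free posterior standard deviation `σ(x; xs) = inf_{λ > 0} σ_{λ²}(x; xs)`. -/
def postStd {X ι : Type*} [Fintype ι] [DecidableEq ι] (k : X → X → ℝ)
    (xs : ι → X) (x : X) : ℝ :=
  ⨅ lam : {l : ℝ // 0 < l}, Real.sqrt (postVar k xs lam.1 x)

/-- Maximum information gain `γ_T(λ²) = sup_{x₁,…,x_T} (1/2) ln det (I_T + λ⁻² K_T)`,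
a value in `[0, ∞]`. -/
def mig {X : Type*} (k : X → X → ℝ) (T : ℕ) (lam : ℝ) : ENNReal :=
  ⨆ xs : Fin T → X, ENNReal.ofReal
    ((1 / 2) * Real.log ((1 + (lam ^ 2)⁻¹ • gram k xs).det))

/-- The prefix `X_{t-1} = (x₁, …, x_{t-1})` of a finite sequence (`t` is 0-indexed). -/
def pre {X : Type*} {T : ℕ} (xs : Fin T → X) (t : Fin T) : Fin t.1 → X :=
  fun i => xs ⟨i.1, i.2.trans t.2⟩

/-- Noise-free posterior mean `μ(x; xs) = k_t(x)ᵀ K⁻¹ (f(x₁), …, f(x_t))ᵀ`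
(for the empty family this is `0`). -/
def postMean {X ι : Type*} [Fintype ι] [DecidableEq ι] (k : X → X → ℝ)
    (xs : ι → X) (f : X → ℝ) (x : X) : ℝ :=
  kvec k xs x ⬝ᵥ ((gram k xs)⁻¹ *ᵥ fun i => f (xs i))

/-- Noise-free posterior standard deviation in closed form,
`σ(x; xs) = (k(x,x) - k_t(x)ᵀ K⁻¹ k_t(x))^{1/2}` (for the empty family, `k(x,x)^{1/2}`). -/
def postStdInv {X ι : Type*} [Fintype ι] [DecidableEq ι] (k : X → X → ℝ)
    (xs : ι → X) (x : X) : ℝ :=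
  Real.sqrt (k x x - kvec k xs x ⬝ᵥ ((gram k xs)⁻¹ *ᵥ kvec k xs x))

/-- The first `t` points `X_t = (x₁, …, x_t)` of an infinite sequence. -/
def prefN {X : Type*} (xseq : ℕ → X) (t : ℕ) : Fin t → X := fun i => xseq i

/-- A positive-semidefinite kernel has positive-semidefinite Gram matrices. -/
theorem gram_posSemidef {X : Type*} {k : X → X → ℝ} (hsym : ∀ x y : X, k x y = k y x)
    (hpsd : ∀ (n : ℕ) (xv : Fin n → X) (c : Fin n → ℝ),
      0 ≤ ∑ i, ∑ j, c i * c j * k (xv i) (xv j)) {n : ℕ} (xs : Fin n → X) :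
    (gram k xs).PosSemidef := by
  refine .of_dotProduct_mulVec_nonneg (Matrix.IsHermitian.ext fun i j => ?_) fun c => ?_
  · simp [_root_.gram, hsym (xs i)]
  · refine (hpsd n xs c).trans_eq ?_
    simp only [dotProduct, mulVec, _root_.gram, star_trivial, Finset.mul_sum]
    exact Finset.sum_congr rfl fun i _ => Finset.sum_congr rfl fun j _ => by ring

theorem posDef_gram_add {X ι : Type*} [Fintype ι] [DecidableEq ι] {k : X → X → ℝ} {xs : ι → X}
    (h : (gram k xs).PosSemidef) {lam : ℝ} (hlam : 0 < lam) :
    (gram k xs + lam ^ 2 • (1 : Matrix ι ι ℝ)).PosDef :=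
  Matrix.PosDef.posSemidef_add h (Matrix.PosDef.one.smul (by positivity))

/-- Variational lower bound for the quadratic form of an inverse matrix. -/
theorem two_mul_dotProduct_sub_le_inv {ι : Type*} [Fintype ι] [DecidableEq ι]
    {A : Matrix ι ι ℝ} (hA : A.PosDef) (v c : ι → ℝ) :
    2 * (c ⬝ᵥ v) - c ⬝ᵥ (A *ᵥ c) ≤ v ⬝ᵥ (A⁻¹ *ᵥ v) := by
  have hAv : A *ᵥ (A⁻¹ *ᵥ v) = v := by
    rw [mulVec_mulVec, mul_nonsing_inv _ ((isUnit_iff_isUnit_det A).mp hA.isUnit), one_mulVec]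
  have hsymm : (A⁻¹ *ᵥ v) ⬝ᵥ (A *ᵥ c) = c ⬝ᵥ v := by
    have hT : Aᵀ = A := by simpa using hA.isHermitian.eq
    rw [dotProduct_mulVec, ← mulVec_transpose, hT, hAv, dotProduct_comm]
  have h := hA.posSemidef.dotProduct_mulVec_nonneg (c - A⁻¹ *ᵥ v)
  simp only [star_trivial, mulVec_sub, sub_dotProduct, dotProduct_sub, hAv, hsymm] at h
  rw [dotProduct_comm (A⁻¹ *ᵥ v) v] at h
  linarith

theorem postVar_le_self {X ι : Type*} [Fintype ι] [DecidableEq ι] {k : X → X → ℝ} {xs : ι → X}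
    (h : (gram k xs).PosSemidef) {lam : ℝ} (hlam : 0 < lam) (x : X) :
    postVar k xs lam x ≤ k x x := by
  have := two_mul_dotProduct_sub_le_inv (posDef_gram_add h hlam) (kvec k xs x) 0
  simp only [zero_dotProduct, mul_zero, sub_zero] at this
  unfold postVar
  linarith

/-- The posterior variance decreases when observations are added. -/
theorem postVar_le_comp {X ι κ : Type*} [Fintype ι] [DecidableEq ι] [Fintype κ] [DecidableEq κ]
    {k : X → X → ℝ} {xs : κ → X} {e : ι → κ} (he : e.Injective)
    (h : (gram k xs).PosSemidef) {lam : ℝ} (hlam : 0 < lam) (x : X) :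
    postVar k xs lam x ≤ postVar k (xs ∘ e) lam x := by
  set A := gram k xs + lam ^ 2 • (1 : Matrix κ κ ℝ) with hAdef
  have hsub : gram k (xs ∘ e) + lam ^ 2 • (1 : Matrix ι ι ℝ) = A.submatrix e e := by
    ext i j
    simp [hAdef, _root_.gram, Matrix.one_apply, he.eq_iff]
  have hA : A.PosDef := posDef_gram_add h hlam
  set v := kvec k (xs ∘ e) x with hv
  set c := (A.submatrix e e)⁻¹ *ᵥ v with hc
  have hAc : A.submatrix e e *ᵥ c = v := by
    rw [hc, mulVec_mulVec, mul_nonsing_inv _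
      ((isUnit_iff_isUnit_det _).mp (hA.submatrix he).isUnit), one_mulVec]
  have hzero : ∀ i ∉ Set.range e, Function.extend e c 0 i = 0 := fun i hi =>
    Function.extend_apply' _ _ _ (by simpa using hi)
  have hext : ∀ w : κ → ℝ, Function.extend e c 0 ⬝ᵥ w = c ⬝ᵥ (w ∘ e) := fun w =>
    (Fintype.sum_of_injective e he _ _ (fun i hi => by simp [hzero i hi])
      fun i => by simp [he.extend_apply]).symm
  have hmul : (A *ᵥ Function.extend e c 0) ∘ e = A.submatrix e e *ᵥ c := by
    ext i
    simp only [Function.comp_apply, mulVec]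
    rw [dotProduct_comm, hext, dotProduct_comm]
    rfl
  have key := two_mul_dotProduct_sub_le_inv hA (kvec k xs x) (Function.extend e c 0)
  rw [hext, hext, hmul, hAc] at key
  have hvc : kvec k xs x ∘ e = v := rfl
  rw [hvc] at key
  unfold postVar
  rw [hsub, ← hv, ← hc, dotProduct_comm v c]
  linarith

/-- Adding one observation multiplies the information-gain determinant by
`1 + λ⁻² σ²_{λ²}`. -/
theorem det_one_add_gram_succ {X : Type*} {k : X → X → ℝ} (hsym : ∀ x y : X, k x y = k y x)
    {n : ℕ} (ys : Fin (n + 1) → X) (h : (gram k (ys ∘ Fin.castSucc)).PosSemidef)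
    {lam : ℝ} (hlam : 0 < lam) :
    (1 + (lam ^ 2)⁻¹ • gram k ys).det =
      (1 + (lam ^ 2)⁻¹ • gram k (ys ∘ Fin.castSucc)).det *
        (1 + (lam ^ 2)⁻¹ * postVar k (ys ∘ Fin.castSucc) lam (ys (Fin.last n))) := by
  have hl : lam ^ 2 ≠ 0 := by positivity
  set G := gram k (ys ∘ Fin.castSucc) with hG
  set v := kvec k (ys ∘ Fin.castSucc) (ys (Fin.last n)) with hv
  have hB : (G + lam ^ 2 • (1 : Matrix (Fin n) (Fin n) ℝ)).PosDef := posDef_gram_add h hlam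
  have hBdet := (isUnit_iff_isUnit_det _).mp hB.isUnit
  have hA : 1 + (lam ^ 2)⁻¹ • G =
      (lam ^ 2)⁻¹ • (G + lam ^ 2 • (1 : Matrix (Fin n) (Fin n) ℝ)) := by
    rw [smul_add, smul_smul, inv_mul_cancel₀ hl, one_smul, add_comm]
  have hAinv : (1 + (lam ^ 2)⁻¹ • G) *
      (lam ^ 2 • (G + lam ^ 2 • (1 : Matrix (Fin n) (Fin n) ℝ))⁻¹) = 1 := by
    rw [hA, smul_mul_smul_comm, inv_mul_cancel₀ hl, one_smul, mul_nonsing_inv _ hBdet]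
  let _ : Invertible (1 + (lam ^ 2)⁻¹ • G) := invertibleOfRightInverse _ _ hAinv
  have hinvOf : ⅟(1 + (lam ^ 2)⁻¹ • G) =
      lam ^ 2 • (G + lam ^ 2 • (1 : Matrix (Fin n) (Fin n) ℝ))⁻¹ := rfl
  have hcast : ∀ i : Fin n, Fin.castAdd 1 i = i.castSucc := fun _ => rfl
  have hlast : ∀ i : Fin 1, Fin.natAdd n i = Fin.last n := fun i => by
    rw [Subsingleton.elim i 0]; rfl
  have hne : ∀ i : Fin n, i.castSucc ≠ Fin.last n := Fin.castSucc_ne_last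
  have hblock : (1 + (lam ^ 2)⁻¹ • gram k ys).submatrix finSumFinEquiv finSumFinEquiv =
      fromBlocks (1 + (lam ^ 2)⁻¹ • G) ((lam ^ 2)⁻¹ • replicateCol (Fin 1) v)
        ((lam ^ 2)⁻¹ • replicateRow (Fin 1) v)
        (of fun _ _ => 1 + (lam ^ 2)⁻¹ * k (ys (Fin.last n)) (ys (Fin.last n))) := by
    ext i j
    rcases i with i | i <;> rcases j with j | j
    · simp [_root_.gram, hG, Matrix.one_apply, hcast]
    · simp [_root_.gram, hv, kvec, hcast, hlast, hne]
    · simp [_root_.gram, hv, kvec, hcast, hlast, (hne _).symm,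
        hsym (ys (Fin.last n))]
    · simp [_root_.gram, hlast, Subsingleton.elim i j]
  rw [← det_submatrix_equiv_self finSumFinEquiv, hblock, det_fromBlocks₁₁, hinvOf]
  congr 1
  rw [det_fin_one]
  have hquad : (replicateRow (Fin 1) v * (G + lam ^ 2 • (1 : Matrix (Fin n) (Fin n) ℝ))⁻¹ *
      replicateCol (Fin 1) v) 0 0 =
        v ⬝ᵥ ((G + lam ^ 2 • (1 : Matrix (Fin n) (Fin n) ℝ))⁻¹ *ᵥ v) := by
    rw [Matrix.mul_assoc, ← replicateCol_mulVec]
    rfl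
  simp only [Matrix.smul_mul, Matrix.mul_smul, Matrix.sub_apply, Matrix.smul_apply,
    of_apply, smul_eq_mul, hquad, postVar,
    ← hG, ← hv]
  field_simp
  ring

/-- If every posterior variance along the sequence is at least `λ²`, the information-gain
determinant is at least `2 ^ n`. -/
theorem two_pow_le_det {X : Type*} {k : X → X → ℝ} (hsym : ∀ x y : X, k x y = k y x)
    (hpsd : ∀ (n : ℕ) (xv : Fin n → X) (c : Fin n → ℝ),
      0 ≤ ∑ i, ∑ j, c i * c j * k (xv i) (xv j)) {lam : ℝ} (hlam : 0 < lam) {n : ℕ}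
    (ys : Fin n → X) (hys : ∀ i, lam ^ 2 ≤ postVar k (pre ys i) lam (ys i)) :
    2 ^ n ≤ (1 + (lam ^ 2)⁻¹ • gram k ys).det := by
  induction n with
  | zero => simp
  | succ n ih =>
    rw [det_one_add_gram_succ hsym ys (gram_posSemidef hsym hpsd _) hlam, pow_succ]
    have hlast : 1 ≤ (lam ^ 2)⁻¹ * postVar k (ys ∘ Fin.castSucc) lam (ys (Fin.last n)) := by
      rw [inv_mul_eq_div, one_le_div (by positivity)]
      exact hys (Fin.last n)
    have := ih (ys ∘ Fin.castSucc) fun i => hys i.castSucc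
    exact mul_le_mul this (by linarith) zero_le_two (this.trans' (by positivity))

theorem postStd_le_sqrt {X ι : Type*} [Fintype ι] [DecidableEq ι] (k : X → X → ℝ) (xs : ι → X)
    (x : X) {lam : ℝ} (hlam : 0 < lam) : postStd k xs x ≤ √(postVar k xs lam x) :=
  ciInf_le (f := fun l : {l : ℝ // 0 < l} => √(postVar k xs l.1 x))
    ⟨0, by rintro _ ⟨l, rfl⟩; exact Real.sqrt_nonneg _⟩ ⟨lam, hlam⟩

/-- A sequence whose information gain is at most `n / 6` has a point with posterior variance
below `λ²`. -/
theorem exists_postVar_lt_of_mig_le {X : Type*} {k : X → X → ℝ}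
    (hsym : ∀ x y : X, k x y = k y x)
    (hpsd : ∀ (n : ℕ) (xv : Fin n → X) (c : Fin n → ℝ),
      0 ≤ ∑ i, ∑ j, c i * c j * k (xv i) (xv j)) {lam : ℝ} (hlam : 0 < lam) {n : ℕ} (hn : 0 < n)
    (hmig : mig k n lam ≤ ENNReal.ofReal ((n : ℝ) / 6)) (ys : Fin n → X) :
    ∃ i, postVar k (pre ys i) lam (ys i) < lam ^ 2 := by
  by_contra! hcon
  have hdet := Real.log_le_log (by positivity) (two_pow_le_det hsym hpsd hlam ys hcon)
  rw [Real.log_pow] at hdet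
  have hle := (le_iSup (fun xs : Fin n → X => ENNReal.ofReal
    ((1 / 2) * Real.log ((1 + (lam ^ 2)⁻¹ • _root_.gram k xs).det))) ys).trans hmig
  rw [ENNReal.ofReal_le_ofReal_iff (by positivity)] at hle
  have hn' : (0 : ℝ) < n := by exact_mod_cast hn
  nlinarith [Real.log_two_gt_d9]

/-- With `λ² = C̃ t^{-2ν/d} (ln t)^{2ν/d} ≤ 1`, the Matérn-type information-gain bound is at most
`t / 6`. -/
theorem matern_gain_le {C Ctil d ν t L : ℝ} (hC : 0 < C) (hd : 0 < d) (hν : 0 < ν) (ht : 4 ≤ t)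
    (hCtil1 : 1 ≤ Ctil)
    (hCtil : (2 + 2 * ν / d) ^ (2 * ν / d) * (6 * C) ^ (1 + 2 * ν / d) ≤ Ctil)
    (hL : L = Ctil * t ^ (-(2 * ν / d)) * Real.log t ^ (2 * ν / d)) (hL1 : L ≤ 1) :
    C * (t / L) ^ (d / (2 * ν + d)) * Real.log (t / L) ^ (2 * ν / (2 * ν + d)) ≤ t / 6 := by
  have ht0 : 0 < t := by linarith
  have hlog : 1 ≤ Real.log t := by
    rw [Real.le_log_iff_exp_le ht0]
    linarith [Real.exp_one_lt_d9]
  have hlog0 : 0 < Real.log t := by linarith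
  have hCtil0 : 0 < Ctil := by linarith
  have hLpos : 0 < L := by rw [hL]; positivity
  have hs : 0 < 2 * ν + d := by positivity
  have hLt : t ^ (-(2 * ν / d)) ≤ L := by
    rw [hL]
    have h1 : 1 ≤ Real.log t ^ (2 * ν / d) := Real.one_le_rpow hlog (by positivity)
    have h2 : 0 < t ^ (-(2 * ν / d)) := by positivity
    calc t ^ (-(2 * ν / d)) = 1 * t ^ (-(2 * ν / d)) * 1 := by ring
      _ ≤ _ := by gcongr
  have hlogL : Real.log (t / L) ≤ (2 + 2 * ν / d) * Real.log t := by
    rw [Real.log_div ht0.ne' hLpos.ne']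
    have := Real.log_le_log (by positivity) hLt
    rw [Real.log_rpow ht0] at this
    linarith
  have hlogL0 : 0 ≤ Real.log (t / L) :=
    Real.log_nonneg ((one_le_div hLpos).mpr (by linarith))
  have hexp : 2 * ν / d * (d / (2 * ν + d)) = 2 * ν / (2 * ν + d) := by field_simp
  have hLpow : L ^ (d / (2 * ν + d)) = Ctil ^ (d / (2 * ν + d)) *
      t ^ (-(2 * ν / (2 * ν + d))) * Real.log t ^ (2 * ν / (2 * ν + d)) := by
    rw [hL, Real.mul_rpow (by positivity) (by positivity),
      Real.mul_rpow (by positivity) (by positivity), ← Real.rpow_mul ht0.le,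
      ← Real.rpow_mul hlog0.le, neg_mul, hexp]
  have hCpow : (2 + 2 * ν / d) ^ (2 * ν / (2 * ν + d)) * (6 * C) ≤
      Ctil ^ (d / (2 * ν + d)) := by
    refine le_trans (le_of_eq ?_)
      (Real.rpow_le_rpow (by positivity) hCtil (by positivity : 0 ≤ d / (2 * ν + d)))
    rw [Real.mul_rpow (by positivity) (by positivity), ← Real.rpow_mul (by positivity),
      ← Real.rpow_mul (by positivity)]
    have hexp_one : (1 + 2 * ν / d) * (d / (2 * ν + d)) = 1 := by field_simp; ring
    rw [hexp, hexp_one, Real.rpow_one]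
  have htt : t ^ (d / (2 * ν + d)) = t * t ^ (-(2 * ν / (2 * ν + d))) := by
    conv_rhs => rw [← Real.rpow_one t, ← Real.rpow_mul ht0.le, one_mul, ← Real.rpow_add ht0]
    congr 1
    field_simp
    ring
  have hpow : Real.log (t / L) ^ (2 * ν / (2 * ν + d)) ≤
      (2 + 2 * ν / d) ^ (2 * ν / (2 * ν + d)) * Real.log t ^ (2 * ν / (2 * ν + d)) := by
    rw [← Real.mul_rpow (by positivity) hlog0.le]
    exact Real.rpow_le_rpow hlogL0 hlogL (by positivity)
  rw [Real.div_rpow ht0.le hLpos.le, hLpow, htt]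
  set a := Ctil ^ (d / (2 * ν + d))
  set b := t ^ (-(2 * ν / (2 * ν + d)))
  set l := Real.log t ^ (2 * ν / (2 * ν + d))
  set q := (2 + 2 * ν / d) ^ (2 * ν / (2 * ν + d))
  have ha : 0 < a := by positivity
  have hb : 0 < b := by positivity
  have hl : 0 < l := by positivity
  calc C * (t * b / (a * b * l)) * Real.log (t / L) ^ (2 * ν / (2 * ν + d))
      ≤ C * (t * b / (a * b * l)) * (q * l) := by gcongr
    _ = t / 6 * (q * (6 * C)) / a := by field_simp
    _ ≤ t / 6 := by
      rw [div_le_iff₀ ha]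
      gcongr

/-- Discrete integral comparison for `s ↦ s ^ (-p)`, one step. -/
theorem sub_one_rpow_div_add_le {p m : ℝ} (hp0 : 0 ≤ p) (hp1 : p < 1) (hm : 1 ≤ m) :
    (m - 1) ^ (1 - p) / (1 - p) + m ^ (-p) ≤ m ^ (1 - p) / (1 - p) := by
  have hm0 : 0 < m := by linarith
  have hq : 0 < 1 - p := by linarith
  have hb := rpow_one_add_le_one_add_mul_self (s := -m⁻¹) (p := 1 - p)
    (neg_le_neg (inv_le_one_of_one_le₀ hm)) hq.le (by linarith)
  have hm1 : 1 + -m⁻¹ = (m - 1) / m := by field_simp; ring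
  have hpow : m ^ (1 - p) = m * m ^ (-p) := by
    rw [sub_eq_add_neg, Real.rpow_add hm0, Real.rpow_one]
  rw [hm1, Real.div_rpow (by linarith) hm0.le, div_le_iff₀ (by positivity)] at hb
  have : (1 + (1 - p) * -m⁻¹) * m ^ (1 - p) = m ^ (1 - p) - (1 - p) * m ^ (-p) := by
    rw [hpow]; field_simp; ring
  rw [this] at hb
  rw [div_add' _ _ _ hq.ne', div_le_div_iff_of_pos_right hq]
  linarith

/-- If every subset of at least `N` indices contains a term bounded by `A m^{-p}`, where `m` is its
cardinality, then sums of terms bounded by one grow at most like `N + A m^{1-p} / (1-p)`. -/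
theorem sum_le_of_exists_le {ι : Type*} [DecidableEq ι] {f : ι → ℝ} {N : ℕ} (hN : 0 < N)
    {A p : ℝ} (hA : 0 ≤ A) (hp0 : 0 ≤ p) (hp1 : p < 1) (hf : ∀ i, f i ≤ 1)
    (hex : ∀ S : Finset ι, N ≤ S.card → ∃ i ∈ S, f i ≤ A * (S.card : ℝ) ^ (-p))
    (S : Finset ι) : ∑ i ∈ S, f i ≤ N + A * ((S.card : ℝ) ^ (1 - p) / (1 - p)) := by
  have hq : 0 < 1 - p := by linarith
  induction hm : S.card generalizing S with
  | zero =>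
    rw [Finset.card_eq_zero.mp hm, Finset.sum_empty]
    positivity
  | succ m ih =>
    rcases lt_or_ge S.card N with hlt | hge
    · have h1 : ∑ i ∈ S, f i ≤ S.card := by
        simpa using Finset.sum_le_card_nsmul S f 1 fun i _ => hf i
      have h2 : (S.card : ℝ) ≤ N := by exact_mod_cast hlt.le
      have h3 : 0 ≤ A * (((m + 1 : ℕ) : ℝ) ^ (1 - p) / (1 - p)) := by positivity
      linarith
    · obtain ⟨i, hi, hfi⟩ := hex S hge
      have hrest := ih (S.erase i) (by rw [Finset.card_erase_of_mem hi, hm]; rfl)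
      have hstep := sub_one_rpow_div_add_le (m := ((m + 1 : ℕ) : ℝ)) hp0 hp1 (by simp)
      rw [← Finset.sum_erase_add S f hi]
      rw [hm] at hfi
      have hcast : ((m + 1 : ℕ) : ℝ) - 1 = m := by simp
      rw [hcast] at hstep
      nlinarith [mul_le_mul_of_nonneg_left hstep hA]

/-- Cumulative posterior standard deviation under a Matérn-type information-gain
bound, case d > ν. -/
theorem sum_postStd_matern_d_gt_nu
{X : Type*} [Nonempty X] (k : X → X → ℝ)
    (hsym : ∀ x y : X, k x y = k y x)
    (hpsd : ∀ (n : ℕ) (xv : Fin n → X) (c : Fin n → ℝ),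
      0 ≤ ∑ i, ∑ j, c i * c j * k (xv i) (xv j))
    (hk1 : ∀ x : X, k x x ≤ 1)
    (CMat lamBar : ℝ) (hCMat : 0 < CMat) (hlamBar : 0 < lamBar)
    (T0 : ℕ) (hT0 : 2 ≤ T0) (d : ℕ) (hd : 1 ≤ d) (ν : ℝ) (hν : 0 < ν)
    (hgain : ∀ lam : ℝ, 0 < lam → lam ≤ lamBar → ∀ t : ℕ, T0 ≤ t →
      mig k t lam ≤ ENNReal.ofReal
        (CMat * ((t : ℝ) / lam ^ 2) ^ ((d : ℝ) / (2 * ν + (d : ℝ))) *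
          Real.log ((t : ℝ) / lam ^ 2) ^ (2 * ν / (2 * ν + (d : ℝ)))))
    (Ctil : ℝ) (hCtil : Ctil = max 1
      ((2 + 2 * ν / (d : ℝ)) ^ (2 * ν / (d : ℝ)) * (6 * CMat) ^ (1 + 2 * ν / (d : ℝ))))
    (Tlam : ℕ) (hTlam : ∀ t : ℕ, Tlam ≤ t →
      Ctil * (t : ℝ) ^ (-(2 * ν / (d : ℝ))) * Real.log (t : ℝ) ^ (2 * ν / (d : ℝ)) ≤ lamBar ^ 2)
    (TMat : ℕ) (hTMat : TMat = max 4 (max T0 Tlam))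
    (hdν : ν < (d : ℝ)) :
    ∀ T : ℕ, 0 < T → ∀ xs : Fin T → X,
      ∑ t : Fin T, postStd k (pre xs t) (xs t) ≤
        (TMat : ℝ) + Real.sqrt Ctil * ((d : ℝ) / ((d : ℝ) - ν)) *
          (T : ℝ) ^ (((d : ℝ) - ν) / (d : ℝ)) * Real.log (T : ℝ) ^ (ν / (d : ℝ)) := by
  intro T hT xs
  have hd0 : (0 : ℝ) < d := by exact_mod_cast hd
  have hCtil1 : 1 ≤ Ctil := hCtil ▸ le_max_left _ _
  have hCtil0 : 0 < Ctil := by linarith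
  have hp1 : ν / (d : ℝ) < 1 := (div_lt_one hd0).mpr hdν
  have hstd1 : ∀ t : Fin T, postStd k (pre xs t) (xs t) ≤ 1 := fun t =>
    (postStd_le_sqrt k _ _ one_pos).trans <| Real.sqrt_le_one.mpr <|
      (postVar_le_self (gram_posSemidef hsym hpsd _) one_pos _).trans (hk1 _)
  have hlogT : 0 ≤ Real.log (T : ℝ) := Real.log_natCast_nonneg T
  have hex : ∀ S : Finset (Fin T), TMat ≤ S.card → ∃ t ∈ S, postStd k (pre xs t) (xs t) ≤
      Real.sqrt Ctil * Real.log (T : ℝ) ^ (ν / (d : ℝ)) * (S.card : ℝ) ^ (-(ν / (d : ℝ))) := by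
    intro S hS
    obtain ⟨h4, hST0, hSTlam⟩ : 4 ≤ S.card ∧ T0 ≤ S.card ∧ Tlam ≤ S.card := by omega
    have hm4 : (4 : ℝ) ≤ S.card := by exact_mod_cast h4
    have hm0 : (0 : ℝ) < S.card := by linarith
    have hlogm : 0 < Real.log (S.card : ℝ) := Real.log_pos (by linarith)
    set lam := Real.sqrt Ctil * (S.card : ℝ) ^ (-(ν / (d : ℝ))) *
      Real.log (S.card : ℝ) ^ (ν / (d : ℝ)) with hlamdef
    have hlam : 0 < lam := by positivity
    have hlam2 : lam ^ 2 = Ctil * (S.card : ℝ) ^ (-(2 * ν / (d : ℝ))) *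
        Real.log (S.card : ℝ) ^ (2 * ν / (d : ℝ)) := by
      rw [hlamdef, mul_pow, mul_pow, Real.sq_sqrt hCtil0.le, ← Real.rpow_mul_natCast hm0.le,
        ← Real.rpow_mul_natCast hlogm.le, Nat.cast_ofNat, neg_mul, div_mul_eq_mul_div, mul_comm ν]
    have hlamle : lam ≤ Real.sqrt Ctil * Real.log (T : ℝ) ^ (ν / (d : ℝ)) *
        (S.card : ℝ) ^ (-(ν / (d : ℝ))) := by
      have hcard : (S.card : ℝ) ≤ T := by exact_mod_cast (card_finset_fin_le S)
      rw [hlamdef, mul_right_comm]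
      gcongr
    suffices h : ∃ t ∈ S, postVar k (pre xs t) lam (xs t) ≤ lam ^ 2 by
      obtain ⟨t, ht, hvar⟩ := h
      exact ⟨t, ht, ((postStd_le_sqrt k _ _ hlam).trans (Real.sqrt_le_iff.mpr
        ⟨hlam.le, hvar⟩)).trans hlamle⟩
    rcases le_total 1 (lam ^ 2) with hge | hle
    · obtain ⟨t, ht⟩ := Finset.card_pos.mp (by omega : 0 < S.card)
      exact ⟨t, ht, ((postVar_le_self (gram_posSemidef hsym hpsd _) hlam _).trans
        (hk1 _)).trans hge⟩
    have hlamBar' : lam ≤ lamBar :=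
      (sq_le_sq₀ hlam.le hlamBar.le).mp (hlam2 ▸ hTlam S.card hSTlam)
    have hmig := (hgain lam hlam hlamBar' S.card hST0).trans (ENNReal.ofReal_le_ofReal
      (matern_gain_le hCMat hd0 hν hm4 hCtil1 (hCtil ▸ le_max_right _ _) hlam2 hle))
    let e := S.orderEmbOfFin rfl
    obtain ⟨i, hi⟩ := exists_postVar_lt_of_mig_le hsym hpsd hlam (by omega) hmig (xs ∘ e)
    refine ⟨e i, S.orderEmbOfFin_mem rfl i, le_trans ?_ hi.le⟩
    let g : Fin i.1 → Fin (e i).1 := fun j => ⟨(e ⟨j.1, j.2.trans i.2⟩).1,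
      Fin.lt_def.mp (e.strictMono (Fin.lt_def.mpr j.2))⟩
    have hg : g.Injective := fun a b hab => by
      have := e.injective (Fin.ext (Fin.mk.inj hab))
      exact Fin.ext (Fin.mk.inj this)
    exact postVar_le_comp hg (gram_posSemidef hsym hpsd (pre xs (e i))) hlam _
  have hsum := sum_le_of_exists_le (by omega : 0 < TMat) (by positivity) (by positivity) hp1
    hstd1 hex Finset.univ
  refine hsum.trans_eq ?_
  have hdν' : (d : ℝ) - ν ≠ 0 := by linarith
  have hq : 1 - ν / (d : ℝ) = ((d : ℝ) - ν) / d := by field_simp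
  rw [Finset.card_univ, Fintype.card_fin, hq]
  field_simp
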